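/- Let x_1, …, x_n (n ≥ 1) be a sequence of pairwise distinct integers, let r be the maximum length of a strictly increasing subsequence and let s be the maximum length of a strictly decreasing subsequence. Then r + s ≥ ⌈2√n⌉. -/

import Mathlib

/-- If every chain of a transitive relation has at most `r` terms, then the relation maps
strictly monotonically into `Fin r`. -/
theorem exists_rank_of_chain_length_le {α : Type*} (R : α → α → Prop)
    (htrans : ∀ a b c, R a b → R b c → R a c) (r : ℕ)
    (h : ∀ (k : ℕ) (t : Fin k → α), (∀ a b, a < b → R (t a) (t b)) → k ≤ r) :
    ∃ f : α → Fin r, ∀ i j, R i j → f i < f j := by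
  classical
  let P : α → ℕ → Prop := fun i k =>
    ∃ t : Fin (k + 1) → α, (∀ a b, a < b → R (t a) (t b)) ∧ t (Fin.last k) = i
  have hP0 : ∀ i, P i 0 := fun i =>
    ⟨fun _ => i, fun a b hab => absurd hab (by omega), rfl⟩
  have hPlt : ∀ i k, P i k → k < r := fun i k ⟨t, ht, _⟩ => h _ t ht
  have hspec : ∀ i, P i (Nat.findGreatest (P i) r) := fun i =>
    Nat.findGreatest_spec (Nat.zero_le r) (hP0 i)
  refine ⟨fun i => ⟨Nat.findGreatest (P i) r, hPlt i _ (hspec i)⟩, fun i j hij => ?_⟩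
  have hj : P j (Nat.findGreatest (P i) r + 1) := by
    obtain ⟨t, ht, hti⟩ := hspec i
    refine ⟨Fin.snoc (α := fun _ => α) t j, fun a b hab => ?_, Fin.snoc_last _ _⟩
    have hlast : ∀ c, R (t c) j := fun c => by
      rcases (Fin.le_last c).eq_or_lt with rfl | hc
      · rwa [hti]
      · exact htrans _ _ _ (hti ▸ ht _ _ hc) hij
    induction a using Fin.lastCases with
    | last => exact absurd hab (Fin.le_last b).not_gt
    | cast a =>
      induction b using Fin.lastCases with
      | last => simpa using hlast a
      | cast b => simpa using ht a b (by simpa using hab)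
  exact Nat.lt_of_succ_le (Nat.le_findGreatest (hPlt j _ hj).le hj)


/-- a variant of the Erdős–Szekeres theorem.  Let `x_1, …, x_n`
(`n ≥ 1`) be a sequence of pairwise distinct integers, let `r` be the maximum length of a
strictly increasing subsequence and `s` the maximum length of a strictly decreasing
subsequence.  Then `r + s ≥ ⌈2√n⌉`. -/
theorem stmt13 (n : ℕ) (hn : 1 ≤ n) (x : Fin n → ℤ) (hx : Function.Injective x)
    (r s : ℕ)
    (hr1 : ∃ t : Fin r → Fin n, StrictMono t ∧ StrictMono (x ∘ t))
    (hr2 : ∀ (k : ℕ) (t : Fin k → Fin n), StrictMono t → StrictMono (x ∘ t) → k ≤ r)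
    (hs1 : ∃ t : Fin s → Fin n, StrictMono t ∧ StrictAnti (x ∘ t))
    (hs2 : ∀ (k : ℕ) (t : Fin k → Fin n), StrictMono t → StrictAnti (x ∘ t) → k ≤ s) :
    ⌈2 * Real.sqrt n⌉₊ ≤ r + s := by
  obtain ⟨f, hf⟩ := exists_rank_of_chain_length_le (fun i j => i < j ∧ x i < x j)
    (fun _ _ _ h₁ h₂ => ⟨h₁.1.trans h₂.1, h₁.2.trans h₂.2⟩) r
    (fun k t ht => hr2 k t (fun a b hab => (ht a b hab).1) (fun a b hab => (ht a b hab).2))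
  obtain ⟨g, hg⟩ := exists_rank_of_chain_length_le (fun i j => i < j ∧ x j < x i)
    (fun _ _ _ h₁ h₂ => ⟨h₁.1.trans h₂.1, h₂.2.trans h₁.2⟩) s
    (fun k t ht => hs2 k t (fun a b hab => (ht a b hab).1) (fun a b hab => (ht a b hab).2))
  have hne : ∀ i j, i < j → (f i, g i) ≠ (f j, g j) := by
    intro i j hij heq
    rw [Prod.mk.injEq] at heq
    rcases lt_or_gt_of_ne (hx.ne hij.ne) with h | h
    · exact (hf i j ⟨hij, h⟩).ne heq.1
    · exact (hg i j ⟨hij, h⟩).ne heq.2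
  have hinj : Function.Injective fun i => (f i, g i) := by
    intro i j heq
    by_contra hij
    rcases lt_or_gt_of_ne hij with h | h
    · exact hne i j h heq
    · exact hne j i h heq.symm
  have hcard : n ≤ r * s := by
    simpa using Fintype.card_le_of_injective _ hinj
  have hcard' : (n : ℝ) ≤ r * s := by exact_mod_cast hcard
  have hsqrt : Real.sqrt n ≤ ((r : ℝ) + s) / 2 :=
    Real.sqrt_le_iff.mpr ⟨by positivity, by nlinarith [sq_nonneg ((r : ℝ) - s)]⟩
  rw [Nat.ceil_le]
  push_cast
  linarith
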